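/- Assume relation (R1) holds in R. Then for all 1 ≤ i < p < j ≤ n+1 one has [e_{i,p}, e_{p,j}]_c = e_{i,j}; that is, e_{i,p}·e_{p,j} − B(i,p;p,j)·e_{p,j}·e_{i,p} = e_{i,j}. (Lemma 'lema2.2.200', equation (2.2.6).) -/

import Mathlib

/-- `B(i,j;p,r) = ∏_{i≤ℓ≤j−1} ∏_{p≤h≤r−1} q_{ℓ,h}`. -/
def Bq {k : Type*} [Field k] (qm : ℕ → ℕ → k) (i j p r : ℕ) : k :=
  ∏ l ∈ Finset.Ico i j, ∏ h ∈ Finset.Ico p r, qm l h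

/-- The iterated braided commutators `e_{i,j}`: `e_{i,i+1} = x_i` and
`e_{i,j} = e_{i,j−1}·e_{j−1,j} − B(i,j−1;j−1,j)·e_{j−1,j}·e_{i,j−1}` for `j − i ≥ 2`. -/
def ee {k R : Type*} [Field k] [Ring R] [Algebra k R]
    (qm : ℕ → ℕ → k) (x : ℕ → R) : ℕ → ℕ → R
  | i, j =>
    if _ : j ≤ i + 1 then x i
    else
      ee qm x i (j - 1) * ee qm x (j - 1) j
        - Bq qm i (j - 1) (j - 1) j • (ee qm x (j - 1) j * ee qm x i (j - 1))
  termination_by i j => j - i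
  decreasing_by all_goals omega

section

variable {k R : Type*} [Field k] [Ring R] [Algebra k R]

theorem Bq_mul_left (qm : ℕ → ℕ → k) {i m j : ℕ} (p r : ℕ) (him : i ≤ m) (hmj : m ≤ j) :
    Bq qm i m p r * Bq qm m j p r = Bq qm i j p r :=
  Finset.prod_Ico_consecutive _ him hmj

theorem Bq_mul_right (qm : ℕ → ℕ → k) (i j : ℕ) {p m r : ℕ} (hpm : p ≤ m) (hmr : m ≤ r) :
    Bq qm i j p m * Bq qm i j m r = Bq qm i j p r := by
  simp only [Bq, ← Finset.prod_mul_distrib, Finset.prod_Ico_consecutive _ hpm hmr]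

theorem ee_succ_self (qm : ℕ → ℕ → k) (x : ℕ → R) (i : ℕ) : ee qm x i (i + 1) = x i := by
  rw [ee, dif_pos le_rfl]

theorem ee_succ (qm : ℕ → ℕ → k) (x : ℕ → R) {i j : ℕ} (hij : i < j) :
    ee qm x i (j + 1) =
      ee qm x i j * x j - Bq qm i j j (j + 1) • (x j * ee qm x i j) := by
  rw [ee, dif_neg (by omega), Nat.add_sub_cancel, ee_succ_self]

theorem qcomm_qcommutator {a b c : R} {β γ δ : k} (ha : a * c = β • (c * a))
    (hb : b * c = γ • (c * b)) :
    (a * b - δ • (b * a)) * c = (β * γ) • (c * (a * b - δ • (b * a))) := by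
  have hab : a * b * c = (β * γ) • (c * (a * b)) := by
    rw [mul_assoc, hb, mul_smul_comm, ← mul_assoc, ha, smul_mul_assoc, smul_smul, mul_assoc,
      mul_comm]
  have hba : b * a * c = (β * γ) • (c * (b * a)) := by
    rw [mul_assoc, ha, mul_smul_comm, ← mul_assoc, hb, smul_mul_assoc, smul_smul, mul_assoc]
  rw [sub_mul, smul_mul_assoc, hab, hba, mul_sub, mul_smul_comm, smul_sub, smul_comm δ]

theorem qcommutator_assoc {a b c : R} {β γ δ : k} (h : a * c = γ • (c * a)) :
    a * (b * c - δ • (c * b)) - (β * γ) • ((b * c - δ • (c * b)) * a) =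
      (a * b - β • (b * a)) * c - (γ * δ) • (c * (a * b - β • (b * a))) := by
  have hacb : a * (c * b) = γ • (c * (a * b)) := by
    rw [← mul_assoc, h, smul_mul_assoc, mul_assoc]
  have hbac : b * a * c = γ • (b * (c * a)) := by
    rw [mul_assoc, h, mul_smul_comm]
  simp only [mul_sub, sub_mul, mul_smul_comm, smul_mul_assoc, hacb, hbac, mul_assoc a b c,
    mul_assoc b c a, mul_assoc c b a]
  module

theorem ee_mul_of_lt {n : ℕ} {qm : ℕ → ℕ → k} {x : ℕ → R}
    (R1 : ∀ i p, 1 ≤ i → i < p → p ≤ n → i + 2 ≤ p → x i * x p = qm i p • (x p * x i))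
    {i p m : ℕ} (hi : 1 ≤ i) (hip : i < p) (hpm : p < m) (hm : m ≤ n) :
    ee qm x i p * x m = Bq qm i p m (m + 1) • (x m * ee qm x i p) := by
  have hx : ∀ l, 1 ≤ l → l + 2 ≤ m →
      x l * x m = Bq qm l (l + 1) m (m + 1) • (x m * x l) := fun l hl hlm => by
    simpa [Bq] using R1 l m hl (by omega) hm hlm
  induction p, hip using Nat.le_induction with
  | base => simpa only [Nat.succ_eq_add_one, ee_succ_self] using hx i hi hpm
  | succ p hip ih =>
    rw [ee_succ qm x hip, ← Bq_mul_left qm m (m + 1) (by omega : i ≤ p) p.le_succ]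
    exact qcomm_qcommutator (ih (by omega)) (hx p (by omega) hpm)

end

/-- Lemma `lema2.2.200`, equation (2.2.6): if (R1) holds, then `[e_{i,p}, e_{p,j}]_c = e_{i,j}` for `i < p < j`. -/
theorem lema2_2_200_merge {k R : Type*} [Field k] [Ring R] [Algebra k R]
    (n N : ℕ) (hn : 1 ≤ n) (hN : 2 < N) (q : k) (hq : IsPrimitiveRoot q N)
    (qm : ℕ → ℕ → k)
    (hqne : ∀ i j, 1 ≤ i → i ≤ n → 1 ≤ j → j ≤ n → qm i j ≠ 0)
    (hdiag : ∀ i, 1 ≤ i → i ≤ n → qm i i = q)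
    (hadj : ∀ i j, 1 ≤ i → i ≤ n → 1 ≤ j → j ≤ n → (i = j + 1 ∨ j = i + 1) →
      qm i j * qm j i = q⁻¹)
    (hfar : ∀ i j, 1 ≤ i → i ≤ n → 1 ≤ j → j ≤ n → (i + 2 ≤ j ∨ j + 2 ≤ i) →
      qm i j * qm j i = 1)
    (x : ℕ → R)
    (R1 : ∀ i p, 1 ≤ i → i < p → p ≤ n → i + 2 ≤ p →
      x i * x p = qm i p • (x p * x i))
    : ∀ i p j, 1 ≤ i → i < p → p < j → j ≤ n + 1 →
      ee qm x i p * ee qm x p j - Bq qm i p p j • (ee qm x p j * ee qm x i p)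
        = ee qm x i j := by
  intro i p j hi hip hpj hj
  induction j, hpj using Nat.le_induction with
  | base => rw [Nat.succ_eq_add_one, ee_succ_self, ee_succ qm x hip]
  | succ j hpj ih =>
    rw [ee_succ qm x hpj, ee_succ qm x (hip.trans hpj), ← ih (by omega),
      ← Bq_mul_right qm i p (by omega : p ≤ j) j.le_succ,
      ← Bq_mul_left qm j (j + 1) hip.le (by omega : p ≤ j)]
    exact qcommutator_assoc (ee_mul_of_lt R1 hi hip hpj (by omega))
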